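/- Let G be a simple graph on N vertices, let 0 < ε < 1, D > 0, and m ≥ 0 be real numbers, and suppose every vertex v has degree deg(v) satisfying D(1−ε) < deg(v) and deg(v) ≥ 1. Let A be the column-normalized adjacency matrix of G, i.e., A(i,j) = 1/deg(j) if i and j are adjacent and 0 otherwise. Let the vertex set be partitioned into k blocks V_1, …, V_k, and let A_j denote the N×|V_j| submatrix of A consisting of the columns indexed by V_j. Suppose that for every vertex i and every block j, the number of neighbors of i lying in V_j is at most m. Then √k · max_{1≤j≤k} ‖A_j‖₂ ≤ √(k·m/(D(1−ε))), where ‖·‖₂ denotes the induced 2-norm. -/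

import Mathlib

open Matrix

noncomputable section

/-- The induced 2-norm (L2 operator norm) of a real matrix: the operator norm of the
associated linear map between Euclidean spaces. -/
def l2OpNorm {m n : Type*} [Fintype m] [Fintype n] [DecidableEq n]
    (M : Matrix m n ℝ) : ℝ :=
  ‖LinearMap.toContinuousLinearMap (Matrix.toEuclideanLin M)‖

/-- Schur test: a matrix with nonnegative entries, row sums at most `R` and column sums at most
`C` has 2-norm at most `√(R * C)`. -/
theorem l2OpNorm_le_sqrt_of_sum_le {m n : Type*} [Fintype m] [Fintype n] [DecidableEq n]
    (M : Matrix m n ℝ) {R C : ℝ} (hR : 0 ≤ R) (hM : ∀ i j, 0 ≤ M i j)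
    (hrow : ∀ i, ∑ j, M i j ≤ R) (hcol : ∀ j, ∑ i, M i j ≤ C) :
    l2OpNorm M ≤ Real.sqrt (R * C) := by
  refine ContinuousLinearMap.opNorm_le_bound _ (Real.sqrt_nonneg _) fun x => ?_
  rw [EuclideanSpace.norm_eq, EuclideanSpace.norm_eq, ← Real.sqrt_mul' _ (by positivity)]
  apply Real.sqrt_le_sqrt
  simp only [Real.norm_eq_abs, sq_abs]
  calc ∑ i, (LinearMap.toContinuousLinearMap (Matrix.toEuclideanLin M) x i) ^ 2
      = ∑ i, (∑ j, M i j * x j) ^ 2 := rfl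
    _ ≤ ∑ i, R * ∑ j, M i j * x j ^ 2 := by
        refine Finset.sum_le_sum fun i _ => ?_
        have hsum : 0 ≤ ∑ j, M i j * x j ^ 2 :=
          Finset.sum_nonneg fun j _ => mul_nonneg (hM i j) (sq_nonneg _)
        exact (Finset.sum_sq_le_sum_mul_sum_of_sq_le_mul Finset.univ (fun j _ => hM i j)
          (fun j _ => mul_nonneg (hM i j) (sq_nonneg (x j))) (fun j _ => (by ring : _ = _).le)).trans
          (mul_le_mul_of_nonneg_right (hrow i) hsum)
    _ = R * ∑ j, (∑ i, M i j) * x j ^ 2 := by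
        rw [← Finset.mul_sum, Finset.sum_comm]
        simp only [Finset.sum_mul]
    _ ≤ R * ∑ j, C * x j ^ 2 := by
        gcongr with j
        exact hcol j
    _ = R * C * ∑ j, x j ^ 2 := by rw [← Finset.mul_sum, mul_assoc]

/-- column-block norm bound for the column-normalized adjacency matrix.
The vertex set is partitioned into `k` blocks by `c : Fin N → Fin k`; `A_j` is the submatrix
of the columns indexed by block `j`. If every vertex has degree `≥ 1` and `> D(1-ε)`, and
every vertex has at most `m` neighbors in each block, then
`√k · max_j ‖A_j‖₂ ≤ √(k·m/(D(1-ε)))`. -/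
theorem colBlockNorm_colNormalized_adjacency (N k : ℕ) (hk : 0 < k)
    (G : SimpleGraph (Fin N)) [DecidableRel G.Adj]
    (ε D m : ℝ) (hε0 : 0 < ε) (hε1 : ε < 1) (hD : 0 < D) (hm : 0 ≤ m)
    (hdeg : ∀ v : Fin N, D * (1 - ε) < (G.degree v : ℝ) ∧ 1 ≤ G.degree v)
    (c : Fin N → Fin k)
    (A : Matrix (Fin N) (Fin N) ℝ)
    (hA : ∀ i j, A i j = if G.Adj i j then 1 / (G.degree j : ℝ) else 0)
    (hblock : ∀ (i : Fin N) (j : Fin k),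
      ((Finset.univ.filter fun v => G.Adj i v ∧ c v = j).card : ℝ) ≤ m) :
    Real.sqrt k *
        (⨆ j : Fin k,
          l2OpNorm (Matrix.of fun (i : Fin N) (v : {v : Fin N // c v = j}) => A i v.1))
      ≤ Real.sqrt (k * m / (D * (1 - ε))) := by
  have hd : 0 < D * (1 - ε) := mul_pos hD (sub_pos.2 hε1)
  have : Nonempty (Fin k) := ⟨⟨0, hk⟩⟩
  rw [mul_div_assoc, Real.sqrt_mul (Nat.cast_nonneg k)]
  refine mul_le_mul_of_nonneg_left (ciSup_le fun j => ?_) (Real.sqrt_nonneg _)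
  have hA0 : ∀ i v, 0 ≤ A i v := fun i v => by
    rw [hA]
    positivity
  rw [← mul_one (m / (D * (1 - ε)))]
  refine l2OpNorm_le_sqrt_of_sum_le _ (by positivity) (fun i v => hA0 i v) (fun i => ?_)
    (fun v => ?_)
  · calc ∑ v : {v : Fin N // c v = j}, A i v
        = ∑ v with c v = j, A i v :=
          (Finset.sum_subtype _ (by simp) (fun v => A i v)).symm
      _ ≤ ∑ v with c v = j, if G.Adj i v then 1 / (D * (1 - ε)) else 0 := by
          refine Finset.sum_le_sum fun v _ => ?_
          rw [hA]
          split_ifs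
          · exact one_div_le_one_div_of_le hd (hdeg v).1.le
          · exact le_rfl
      _ = (Finset.univ.filter fun v => G.Adj i v ∧ c v = j).card * (1 / (D * (1 - ε))) := by
          rw [← Finset.sum_filter, Finset.filter_filter, Finset.sum_const, nsmul_eq_mul]
          simp only [and_comm]
      _ ≤ m / (D * (1 - ε)) := by
          rw [mul_one_div]
          exact div_le_div_of_nonneg_right (hblock i j) hd.le
  · have hpos : (G.degree v.1 : ℝ) ≠ 0 := (hd.trans (hdeg v.1).1).ne'
    simp only [Matrix.of_apply, hA, G.adj_comm _ v.1]
    rw [← Finset.sum_filter, Finset.sum_const, ← SimpleGraph.neighborFinset_eq_filter,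
      SimpleGraph.card_neighborFinset_eq_degree, nsmul_eq_mul, mul_one_div_cancel hpos]

end
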